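/- Let G be a node-weighted 3-edge-connected cubic graph with node-weight function f: V → ℝ⁺, so the weight of each edge uv is f(u) + f(v). Then the optimal value of the subtour elimination LP on G equals 2·∑_{v∈V} f(v). -/

import Mathlib

open Finset
open scoped Classical

/-- The set of edges of `G` with exactly one endpoint in `S`. -/
noncomputable def cutEdges {V : Type*} [Fintype V] [DecidableEq V] (G : SimpleGraph V)
    [DecidableRel G.Adj] (S : Finset V) : Finset (Sym2 V) :=
  G.edgeFinset.filter (fun e => ∃ u ∈ S, ∃ v, v ∉ S ∧ e = s(u, v))

/-- The node-induced edge weight: `w(uv) = f(u) + f(v)`. -/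
noncomputable def ew {V : Type*} (f : V → ℝ) : Sym2 V → ℝ :=
  Sym2.lift ⟨fun u v => f u + f v, fun u v => by ring⟩

theorem cutEdges_singleton_aux {V : Type*} [Fintype V] [DecidableEq V] (G : SimpleGraph V)
    [DecidableRel G.Adj] (v : V) :
    cutEdges G {v} = G.edgeFinset.filter (fun e => v ∈ e) := by
  ext e
  induction e using Sym2.ind with
  | _ a b =>
    simp only [cutEdges, Finset.mem_filter, SimpleGraph.mem_edgeFinset, SimpleGraph.mem_edgeSet,
      Finset.mem_singleton]
    refine and_congr_right fun hab => ?_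
    have hne := hab.ne
    constructor
    · rintro ⟨u, rfl, w, hw, h⟩
      rw [h]
      exact Sym2.mem_mk_left _ _
    · intro h
      rcases Sym2.mem_iff.1 h with rfl | rfl
      · exact ⟨_, rfl, b, hne.symm, rfl⟩
      · exact ⟨_, rfl, a, hne, Sym2.eq_swap⟩

theorem ew_eq_sum_aux {V : Type*} [Fintype V] [DecidableEq V] (f : V → ℝ) (e : Sym2 V)
    (he : ¬ e.IsDiag) : ew f e = ∑ v : V, if v ∈ e then f v else 0 := by
  induction e using Sym2.ind with
  | _ a b =>
    have hne : a ≠ b := by simpa using he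
    rw [← Finset.sum_filter]
    have : (Finset.univ.filter (fun v => v ∈ s(a, b))) = {a, b} := by
      ext v; simp
    rw [this, Finset.sum_pair hne]
    rfl

theorem obj_eq_aux {V : Type*} [Fintype V] [DecidableEq V] (G : SimpleGraph V)
    [DecidableRel G.Adj] (f : V → ℝ) (x : Sym2 V → ℝ) :
    ∑ e ∈ G.edgeFinset, ew f e * x e = ∑ v : V, f v * ∑ e ∈ cutEdges G {v}, x e := by
  have h1 : ∀ e ∈ G.edgeFinset, ew f e * x e = ∑ v : V, if v ∈ e then f v * x e else 0 := by
    intro e he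
    rw [ew_eq_sum_aux f e (G.not_isDiag_of_mem_edgeFinset he), Finset.sum_mul]
    simp only [ite_mul, zero_mul]
  rw [Finset.sum_congr rfl h1, Finset.sum_comm]
  refine Finset.sum_congr rfl fun v _ => ?_
  rw [cutEdges_singleton_aux, Finset.mul_sum, Finset.sum_filter]

theorem card_cut_aux {V : Type*} [Fintype V] [DecidableEq V] (G : SimpleGraph V)
    [DecidableRel G.Adj] (v : V) : (cutEdges G {v}).card = G.degree v := by
  rw [cutEdges_singleton_aux, ← G.card_incidenceFinset_eq_degree, G.incidenceFinset_eq_filter]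

/-- For a node-weighted 3-edge-connected cubic graph, the optimal value of the subtour
elimination LP equals `2 ∑_v f(v)`. -/
theorem stmt5 {V : Type*} [Fintype V] [DecidableEq V] (G : SimpleGraph V) [DecidableRel G.Adj]
    (f : V → ℝ) (hf : ∀ v, 0 ≤ f v)
    (hcub : ∀ v : V, G.degree v = 3)
    (h3ec : ∀ T : Finset V, T.Nonempty → T ≠ Finset.univ → 3 ≤ (cutEdges G T).card) :
    IsLeast {z : ℝ | ∃ x : Sym2 V → ℝ, (∀ e, 0 ≤ x e) ∧
        (∀ S : Finset V, S.Nonempty → S ≠ Finset.univ → 2 ≤ ∑ e ∈ cutEdges G S, x e) ∧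
        z = ∑ e ∈ G.edgeFinset, ew f e * x e}
      (2 * ∑ v : V, f v) := by
  constructor
  · refine ⟨fun _ => 2 / 3, fun _ => by norm_num, ?_, ?_⟩
    · intro S h1 h2
      have h : (3 : ℝ) ≤ ((cutEdges G S).card : ℝ) := by exact_mod_cast h3ec S h1 h2
      rw [Finset.sum_const, nsmul_eq_mul]
      linarith
    · rw [obj_eq_aux, Finset.mul_sum]
      refine Finset.sum_congr rfl fun v _ => ?_
      rw [Finset.sum_const, card_cut_aux, hcub, nsmul_eq_mul]
      push_cast
      ring
  · rintro z ⟨x, hx, hS, rfl⟩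
    rw [obj_eq_aux, Finset.mul_sum]
    refine Finset.sum_le_sum fun v _ => ?_
    rw [mul_comm]
    refine mul_le_mul_of_nonneg_left (hS {v} (Finset.singleton_nonempty v) ?_) (hf v)
    intro h
    have hc := G.degree_lt_card_verts v
    rw [hcub, ← Finset.card_univ, ← h] at hc
    simp at hc
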